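/- Let (A,β) be a braided Hopf algebra over a field k. Define θ : A ⋈ A → A* by θ(x ⊗ y)(c) = Σ β(x, c₁) β⁻¹(c₂, y), where A* is the dual vector space of A equipped with the convolution product (f*g)(c) = Σ f(c₁)g(c₂) and unit ε. Then θ is an algebra homomorphism from the double A ⋈ A to the convolution algebra A*: θ(1⊗1) = ε and θ((a⊗b)(a'⊗b')) = θ(a⊗b) * θ(a'⊗b') for all a, b, a', b' ∈ A, where the product (a⊗b)(a'⊗b') is taken in A ⋈ A. -/

import Mathlib

/-!
STATEMENT 9: Let (A,β) be a braided Hopf algebra over a field k.  Define θ : A ⋈ A → A* by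
θ(x⊗y)(c) = Σ β(x,c₁) β⁻¹(c₂,y), where A* carries the convolution product
(f*g)(c) = Σ f(c₁)g(c₂) with unit ε.  Then θ is an algebra homomorphism from the double
A ⋈ A to the convolution algebra A*.
-/

open TensorProduct Coalgebra LinearMap

noncomputable section

variable {k : Type} [Field k]

/-- Convolution product of linear maps from a coalgebra `C` to an algebra `M`:
`(f * g)(c) = Σ f(c₁) g(c₂)`. -/
def conv {C M : Type} [AddCommGroup C] [Module k C] [Coalgebra k C]
    [Ring M] [Algebra k M] (f g : C →ₗ[k] M) : C →ₗ[k] M :=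
  (LinearMap.mul' k M) ∘ₗ (TensorProduct.map f g) ∘ₗ Coalgebra.comul

/-- `Σ g(c₁) • f(c₂)`. -/
def convL {C M : Type} [AddCommGroup C] [Module k C] [Coalgebra k C]
    [AddCommGroup M] [Module k M] (g : C →ₗ[k] k) (f : C →ₗ[k] M) : C →ₗ[k] M :=
  (TensorProduct.lid k M).toLinearMap ∘ₗ (TensorProduct.map g f) ∘ₗ Coalgebra.comul

/-- `Σ g(c₂) • f(c₁)`. -/
def convR {C M : Type} [AddCommGroup C] [Module k C] [Coalgebra k C]
    [AddCommGroup M] [Module k M] (f : C →ₗ[k] M) (g : C →ₗ[k] k) : C →ₗ[k] M :=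
  (TensorProduct.rid k M).toLinearMap ∘ₗ (TensorProduct.map f g) ∘ₗ Coalgebra.comul

/-- Convolution invertibility of a bilinear form. -/
def IsConvInvertible {C : Type} [AddCommGroup C] [Module k C] [Coalgebra k C]
    (τ : C →ₗ[k] k) : Prop :=
  ∃ τi : C →ₗ[k] k, conv τ τi = Coalgebra.counit ∧ conv τi τ = Coalgebra.counit

/-- A skew pairing on the ordered pair `(A, U)`. -/
structure IsSkewPairing {A U : Type} [Ring A] [Ring U] [HopfAlgebra k A] [HopfAlgebra k U]
    (τ : A ⊗[k] U →ₗ[k] k) : Prop where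
  mul_left : ∀ (b c : A) (u : U),
    τ ((b * c) ⊗ₜ u) = conv (τ ∘ₗ TensorProduct.mk k A U b) (τ ∘ₗ TensorProduct.mk k A U c) u
  mul_right : ∀ (b : A) (u v : U),
    τ (b ⊗ₜ (u * v)) =
      conv (τ ∘ₗ (TensorProduct.mk k A U).flip v) (τ ∘ₗ (TensorProduct.mk k A U).flip u) b
  one_left : ∀ u : U, τ (1 ⊗ₜ u) = Coalgebra.counit u
  one_right : ∀ a : A, τ (a ⊗ₜ 1) = Coalgebra.counit a

/-- A braiding on a Hopf algebra `A`. -/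
structure IsBraiding {A : Type} [Ring A] [HopfAlgebra k A] (β : A ⊗[k] A →ₗ[k] k) : Prop where
  skew : IsSkewPairing β
  invertible : IsConvInvertible β
  compat : ∀ a b : A,
    convR ((LinearMap.mul' k A) ∘ₗ (TensorProduct.comm k A A).toLinearMap) β (a ⊗ₜ b)
      = convL β (LinearMap.mul' k A) (a ⊗ₜ b)

variable {A : Type} [Ring A] [HopfAlgebra k A]

/-- The linear map `A ⊗ A → A ⊗ A`, `b ⊗ u ↦ Σ β(b₁,u₁) (b₂ ⊗ u₂) β⁻¹(b₃,u₃)`. -/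
def doubleInner (β βi : A ⊗[k] A →ₗ[k] k) : A ⊗[k] A →ₗ[k] A ⊗[k] A :=
  conv (conv ((Algebra.linearMap k (A ⊗[k] A)) ∘ₗ β) LinearMap.id)
    ((Algebra.linearMap k (A ⊗[k] A)) ∘ₗ βi)

/-- The map `θ : A ⋈ A → A*`, `θ(x⊗y)(c) = Σ β(x,c₁) β⁻¹(c₂,y)`, defined via the bilinear
form `(x⊗y) ⊗ c ↦ Σ β(x,c₁) β⁻¹(c₂,y)`. -/
def theta (β βi : A ⊗[k] A →ₗ[k] k) : A ⊗[k] A →ₗ[k] (A →ₗ[k] k) :=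
  TensorProduct.curry <|
    (LinearMap.mul' k k) ∘ₗ
      TensorProduct.map β (βi ∘ₗ (TensorProduct.comm k A A).toLinearMap) ∘ₗ
      (TensorProduct.tensorTensorTensorComm k A A A A).toLinearMap ∘ₗ
      LinearMap.lTensor (A ⊗[k] A) (Coalgebra.comul (R := k))

open WithConv

section Convolution

variable {B C D E M : Type} [AddCommGroup B] [Module k B] [Coalgebra k B]
  [AddCommGroup C] [Module k C] [Coalgebra k C] [AddCommGroup D] [Module k D] [Coalgebra k D]
  [Ring E] [Algebra k E] [Ring M] [Algebra k M]

/-- Precomposition with a coalgebra homomorphism, as a map of convolution monoids. -/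
def convComap (p : B →ₗc[k] C) : WithConv (C →ₗ[k] E) →* WithConv (B →ₗ[k] E) where
  toFun f := toConv (f.ofConv ∘ₗ p.toLinearMap)
  map_one' := by ext x; simp [LinearMap.convOne_def]
  map_mul' f g := WithConv.ext (convMul_comp_coalgHom_distrib f g p)

variable (k C D) in
/-- The projection `c ⊗ d ↦ ε(d) c`. -/
def tensorFst : C ⊗[k] D →ₗc[k] C :=
  (Coalgebra.TensorProduct.rid k k C).toCoalgHom.comp
    (Coalgebra.TensorProduct.map (.id k C) (counitCoalgHom k D))

variable (k C D) in
/-- The projection `c ⊗ d ↦ ε(c) d`. -/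
def tensorSnd : C ⊗[k] D →ₗc[k] D :=
  (Coalgebra.TensorProduct.lid k D).toCoalgHom.comp
    (Coalgebra.TensorProduct.map (counitCoalgHom k C) (.id k D))

/-- Extend `f` to `c ⊗ d ↦ ε(d) f(c)`. -/
abbrev convInl : WithConv (C →ₗ[k] E) →* WithConv (C ⊗[k] D →ₗ[k] E) :=
  convComap (tensorFst k C D)

/-- Extend `f` to `c ⊗ d ↦ ε(c) f(d)`. -/
abbrev convInr : WithConv (D →ₗ[k] E) →* WithConv (C ⊗[k] D →ₗ[k] E) :=
  convComap (tensorSnd k C D)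

lemma convInl_tmul (f : WithConv (C →ₗ[k] E)) (c : C) (d : D) :
    (convInl f : WithConv (C ⊗[k] D →ₗ[k] E)) (c ⊗ₜ d) = counit (R := k) d • f c := by
  change f (tensorFst k C D (c ⊗ₜ d)) = _
  simp [tensorFst]

lemma convInr_tmul (f : WithConv (D →ₗ[k] E)) (c : C) (d : D) :
    (convInr f : WithConv (C ⊗[k] D →ₗ[k] E)) (c ⊗ₜ d) = counit (R := k) c • f d := by
  change f (tensorSnd k C D (c ⊗ₜ d)) = _
  simp [tensorSnd]

lemma map_comul_tmul {N P : Type} [AddCommGroup N] [Module k N] [AddCommGroup P] [Module k P]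
    (f : C ⊗[k] D →ₗ[k] N) (g : C ⊗[k] D →ₗ[k] P) {c : C} {d : D} {ι κ : Type}
    (rc : Repr k c ι) (rd : Repr k d κ) :
    TensorProduct.map f g (comul (c ⊗ₜ d)) = ∑ i ∈ rc.index, ∑ j ∈ rd.index,
      f (rc.left i ⊗ₜ rd.left j) ⊗ₜ[k] g (rc.right i ⊗ₜ rd.right j) := by
  rw [TensorProduct.comul_tmul, ← rc.eq, ← rd.eq]
  simp only [TensorProduct.sum_tmul, TensorProduct.tmul_sum, map_sum]
  exact Finset.sum_comm

lemma convMul_tmul (f g : WithConv (C ⊗[k] D →ₗ[k] E)) {c : C} {d : D} {ι κ : Type}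
    (rc : Repr k c ι) (rd : Repr k d κ) :
    (f * g) (c ⊗ₜ d) = ∑ i ∈ rc.index, ∑ j ∈ rd.index,
      f (rc.left i ⊗ₜ rd.left j) * g (rc.right i ⊗ₜ rd.right j) := by
  rw [convMul_apply, map_comul_tmul _ _ rc rd]
  simp

lemma sum_counit_right_smul {c : C} {ι : Type} (rc : Repr k c ι) :
    ∑ i ∈ rc.index, counit (R := k) (rc.right i) • rc.left i = c := by
  simpa only [map_sum, TensorProduct.rid_tmul, one_smul] using
    congr(TensorProduct.rid k C $(sum_tmul_counit_eq rc))

lemma convInl_mul_tmul (f : WithConv (C →ₗ[k] E)) (g : WithConv (C ⊗[k] D →ₗ[k] E))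
    {c : C} (d : D) {ι : Type} (rc : Repr k c ι) :
    (convInl f * g : WithConv (C ⊗[k] D →ₗ[k] E)) (c ⊗ₜ d) =
      ∑ i ∈ rc.index, f (rc.left i) * g (rc.right i ⊗ₜ d) := by
  rw [convMul_tmul _ _ rc (ℛ k d)]
  refine Finset.sum_congr rfl fun i _ => ?_
  conv_rhs => rw [← sum_counit_smul (ℛ k d)]
  simp [convInl_tmul, TensorProduct.tmul_sum, Finset.mul_sum]

lemma convInr_mul_tmul (f : WithConv (D →ₗ[k] E)) (g : WithConv (C ⊗[k] D →ₗ[k] E))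
    (c : C) {d : D} {ι : Type} (rd : Repr k d ι) :
    (convInr f * g : WithConv (C ⊗[k] D →ₗ[k] E)) (c ⊗ₜ d) =
      ∑ i ∈ rd.index, f (rd.left i) * g (c ⊗ₜ rd.right i) := by
  rw [convMul_tmul _ _ (ℛ k c) rd, Finset.sum_comm]
  refine Finset.sum_congr rfl fun i _ => ?_
  conv_rhs => rw [← sum_counit_smul (ℛ k c)]
  simp [convInr_tmul, TensorProduct.sum_tmul, ← TensorProduct.smul_tmul', Finset.mul_sum]

lemma mul_convInl_tmul (f : WithConv (C →ₗ[k] E)) (g : WithConv (C ⊗[k] D →ₗ[k] E))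
    {c : C} (d : D) {ι : Type} (rc : Repr k c ι) :
    (g * convInl f : WithConv (C ⊗[k] D →ₗ[k] E)) (c ⊗ₜ d) =
      ∑ i ∈ rc.index, g (rc.left i ⊗ₜ d) * f (rc.right i) := by
  rw [convMul_tmul _ _ rc (ℛ k d)]
  refine Finset.sum_congr rfl fun i _ => ?_
  conv_rhs => rw [← sum_counit_right_smul (ℛ k d)]
  simp [convInl_tmul, TensorProduct.tmul_sum, Finset.sum_mul]

lemma mul_convInr_tmul (f : WithConv (D →ₗ[k] E)) (g : WithConv (C ⊗[k] D →ₗ[k] E))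
    (c : C) {d : D} {ι : Type} (rd : Repr k d ι) :
    (g * convInr f : WithConv (C ⊗[k] D →ₗ[k] E)) (c ⊗ₜ d) =
      ∑ i ∈ rd.index, g (c ⊗ₜ rd.left i) * f (rd.right i) := by
  rw [convMul_tmul _ _ (ℛ k c) rd, Finset.sum_comm]
  refine Finset.sum_congr rfl fun i _ => ?_
  conv_rhs => rw [← sum_counit_right_smul (ℛ k c)]
  simp [convInr_tmul, TensorProduct.sum_tmul, ← TensorProduct.smul_tmul', Finset.sum_mul]

lemma convInl_mul_convInr_tmul (f : WithConv (C →ₗ[k] E)) (g : WithConv (D →ₗ[k] E))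
    (c : C) (d : D) :
    (convInl f * convInr g : WithConv (C ⊗[k] D →ₗ[k] E)) (c ⊗ₜ d) = f c * g d := by
  rw [convInl_mul_tmul _ _ d (ℛ k c)]
  conv_rhs => rw [← sum_counit_right_smul (ℛ k c)]
  simp [convInr_tmul, Finset.sum_mul]

lemma convInr_mul_convInl_tmul (f : WithConv (C →ₗ[k] E)) (g : WithConv (D →ₗ[k] E))
    (c : C) (d : D) :
    (convInr g * convInl f : WithConv (C ⊗[k] D →ₗ[k] E)) (c ⊗ₜ d) = g d * f c := by
  rw [convInr_mul_tmul _ _ c (ℛ k d)]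
  conv_rhs => rw [← sum_counit_right_smul (ℛ k d)]
  simp [convInl_tmul, Finset.sum_mul]

variable (E) in
/-- A linear form, viewed as a map to `E` with scalar values. -/
def convScalar : WithConv (C →ₗ[k] k) →* WithConv (C →ₗ[k] E) where
  toFun f := toConv (Algebra.linearMap k E ∘ₗ f.ofConv)
  map_one' := by ext x; simp [LinearMap.convOne_def]
  map_mul' f g := WithConv.ext (algHom_comp_convMul_distrib (Algebra.ofId k E) f g)

lemma convScalar_apply (f : WithConv (C →ₗ[k] k)) (c : C) :
    convScalar E f c = algebraMap k E (f c) := rfl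

lemma toConv_conv (f g : C →ₗ[k] M) : toConv (conv f g) = toConv f * toConv g := rfl

lemma comp_conv_scalar_left (L : M →ₗ[k] E) (φ : C →ₗ[k] k) (f : C →ₗ[k] M) :
    toConv (L ∘ₗ conv (Algebra.linearMap k M ∘ₗ φ) f) =
      convScalar E (toConv φ) * toConv (L ∘ₗ f) := by
  ext c
  change L ((toConv (Algebra.linearMap k M ∘ₗ φ) * toConv f) c) =
    (convScalar E (toConv φ) * toConv (L ∘ₗ f)) c
  simp [(ℛ k c).convMul_apply, convScalar_apply, ← Algebra.smul_def]

lemma comp_conv_scalar_right (L : M →ₗ[k] E) (φ : C →ₗ[k] k) (f : C →ₗ[k] M) :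
    toConv (L ∘ₗ conv f (Algebra.linearMap k M ∘ₗ φ)) =
      toConv (L ∘ₗ f) * convScalar E (toConv φ) := by
  ext c
  change L ((toConv f * toConv (Algebra.linearMap k M ∘ₗ φ)) c) =
    (toConv (L ∘ₗ f) * convScalar E (toConv φ)) c
  simp [(ℛ k c).convMul_apply, convScalar_apply, ← Algebra.commutes, ← Algebra.smul_def]

end Convolution

section Pairing

/-- The map `x ↦ τ(x, -)` to the convolution algebra `A*`. -/
def pairLeft (τ : A ⊗[k] A →ₗ[k] k) : WithConv (A →ₗ[k] WithConv (A →ₗ[k] k)) :=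
  toConv ((WithConv.linearEquiv k (A →ₗ[k] k)).symm.toLinearMap ∘ₗ TensorProduct.curry τ)

/-- The map `y ↦ τ(-, y)` to the convolution algebra `A*`. -/
def pairRight (τ : A ⊗[k] A →ₗ[k] k) : WithConv (A →ₗ[k] WithConv (A →ₗ[k] k)) :=
  toConv ((WithConv.linearEquiv k (A →ₗ[k] k)).symm.toLinearMap ∘ₗ (TensorProduct.curry τ).flip)

@[simp] lemma pairLeft_apply (τ : A ⊗[k] A →ₗ[k] k) (x c : A) :
    pairLeft τ x c = τ (x ⊗ₜ c) := rfl

@[simp] lemma pairRight_apply (τ : A ⊗[k] A →ₗ[k] k) (y c : A) :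
    pairRight τ y c = τ (c ⊗ₜ y) := rfl

lemma pairRight_mul_pairRight (σ τ : A ⊗[k] A →ₗ[k] k) (h : conv σ τ = Coalgebra.counit) :
    pairRight σ * pairRight τ = 1 := by
  ext y c
  have h' := LinearMap.congr_fun h (c ⊗ₜ y)
  change (toConv σ * toConv τ) (c ⊗ₜ y) = _ at h'
  rw [convMul_tmul _ _ (ℛ k c) (ℛ k y), Finset.sum_comm, TensorProduct.counit_tmul] at h'
  change (pairRight σ * pairRight τ) y c = (1 : WithConv (A →ₗ[k] WithConv (A →ₗ[k] k))) y c
  rw [(ℛ k y).convMul_apply]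
  simp only [WithConv.ofConv_sum, LinearMap.sum_apply, (ℛ k c).convMul_apply, pairRight_apply]
  exact h'

lemma theta_tmul (β βi : A ⊗[k] A →ₗ[k] k) (x y : A) :
    toConv (theta β βi (x ⊗ₜ y)) = pairLeft β x * pairRight βi y := by
  ext c
  change theta β βi (x ⊗ₜ y) c = (pairLeft β x * pairRight βi y) c
  rw [(ℛ k c).convMul_apply]
  simp [theta, ← (ℛ k c).eq, TensorProduct.tmul_sum]

/-- The map `θ` with values in the convolution algebra. -/
def thetaConv (β βi : A ⊗[k] A →ₗ[k] k) : A ⊗[k] A →ₗ[k] WithConv (A →ₗ[k] k) :=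
  (WithConv.linearEquiv k (A →ₗ[k] k)).symm.toLinearMap ∘ₗ theta β βi

lemma thetaConv_tmul (β βi : A ⊗[k] A →ₗ[k] k) (x y : A) :
    thetaConv β βi (x ⊗ₜ y) = pairLeft β x * pairRight βi y :=
  theta_tmul β βi x y

lemma toConv_thetaConv (β βi : A ⊗[k] A →ₗ[k] k) :
    toConv (thetaConv β βi) = convInl (pairLeft β) * convInr (pairRight βi) := by
  refine WithConv.ext (TensorProduct.ext' fun x y => ?_)
  exact (thetaConv_tmul β βi x y).trans (convInl_mul_convInr_tmul _ _ x y).symm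

variable {β βi : A ⊗[k] A →ₗ[k] k}

lemma IsSkewPairing.pairLeft_one (h : IsSkewPairing β) : pairLeft β 1 = 1 :=
  WithConv.ext (LinearMap.ext h.one_left)

lemma IsSkewPairing.pairRight_one (h : IsSkewPairing β) : pairRight β 1 = 1 :=
  WithConv.ext (LinearMap.ext h.one_right)

lemma IsSkewPairing.pairLeft_mul (h : IsSkewPairing β) (x y : A) :
    pairLeft β (x * y) = pairLeft β x * pairLeft β y :=
  WithConv.ext (LinearMap.ext (h.mul_left x y))

lemma IsSkewPairing.pairRight_mul (h : IsSkewPairing β) (x y : A) :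
    pairRight β (x * y) = pairRight β y * pairRight β x :=
  WithConv.ext (LinearMap.ext fun c => h.mul_right c x y)

lemma IsSkewPairing.pairRight_inv_one (h : IsSkewPairing β)
    (hinv : conv β βi = Coalgebra.counit) : pairRight βi 1 = 1 := by
  have := congr($(pairRight_mul_pairRight β βi hinv) (1 : A))
  simpa [h.pairRight_one, Algebra.TensorProduct.one_def] using this

lemma IsSkewPairing.pairRight_inv_mul (h : IsSkewPairing β)
    (hinv₁ : conv β βi = Coalgebra.counit) (hinv₂ : conv βi β = Coalgebra.counit) (x y : A) :
    pairRight βi (x * y) = pairRight βi x * pairRight βi y := by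
  let m : A ⊗[k] A →ₗc[k] A := Bialgebra.mulCoalgHom k A
  have hT : convComap m (pairRight β) = convInr (pairRight β) * convInl (pairRight β) := by
    refine WithConv.ext (TensorProduct.ext' fun u v => ?_)
    exact (h.pairRight_mul u v).trans (convInr_mul_convInl_tmul _ _ u v).symm
  have h₁ : convComap m (pairRight βi) * convComap m (pairRight β) = 1 := by
    rw [← map_mul, pairRight_mul_pairRight _ _ hinv₂, map_one]
  have h₂ : convComap m (pairRight β) *
      (convInl (pairRight βi) * convInr (pairRight βi)) = 1 := by
    rw [hT, mul_assoc, ← mul_assoc (convInl _), ← map_mul,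
      pairRight_mul_pairRight _ _ hinv₁, map_one, one_mul, ← map_mul,
      pairRight_mul_pairRight _ _ hinv₁, map_one]
  have h₃ := congr($(left_inv_eq_right_inv h₁ h₂) (x ⊗ₜ y))
  rwa [convInl_mul_convInr_tmul] at h₃

lemma IsBraiding.sum_compat (hβ : IsBraiding β) {b c : A} {ι κ : Type}
    (rb : Repr k b ι) (rc : Repr k c κ) :
    ∑ i ∈ rb.index, ∑ j ∈ rc.index,
        β (rb.right i ⊗ₜ rc.right j) • (rc.left j * rb.left i) =
      ∑ i ∈ rb.index, ∑ j ∈ rc.index,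
        β (rb.left i ⊗ₜ rc.left j) • (rb.right i * rc.right j) := by
  have h := hβ.compat b c
  simp only [convR, convL, LinearMap.comp_apply, map_comul_tmul _ _ rb rc] at h
  simpa using h

/-- The quantum Yang–Baxter equation for a braiding, in the convolution algebra of
`A ⊗ A` with values in `A*`. -/
lemma IsBraiding.yangBaxter (hβ : IsBraiding β) :
    convInr (pairRight β) * (convScalar _ (toConv β) * convInl (pairLeft β)) =
      convInl (pairLeft β) * (convScalar _ (toConv β) * convInr (pairRight β)) := by
  refine WithConv.ext (TensorProduct.ext' fun b u => WithConv.ext (LinearMap.ext fun c => ?_))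
  have h := congr(pairRight β u $(hβ.sum_compat (ℛ k b) (ℛ k c)))
  have hmul (x y : A) : pairRight β u (x * y) = ∑ i ∈ (ℛ k u).index,
      β (x ⊗ₜ (ℛ k u).left i) * β (y ⊗ₜ (ℛ k u).right i) := by
    rw [pairRight_apply, hβ.skew.mul_left]
    exact (ℛ k u).convMul_apply (toConv (β ∘ₗ TensorProduct.mk k A A x))
      (toConv (β ∘ₗ TensorProduct.mk k A A y))
  change (convInr (pairRight β) * (convScalar _ (toConv β) * convInl (pairLeft β)) :
      WithConv (A ⊗[k] A →ₗ[k] WithConv (A →ₗ[k] k))) (b ⊗ₜ u) c =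
    (convInl (pairLeft β) * (convScalar _ (toConv β) * convInr (pairRight β)) :
      WithConv (A ⊗[k] A →ₗ[k] WithConv (A →ₗ[k] k))) (b ⊗ₜ u) c
  rw [convInr_mul_tmul _ _ b (ℛ k u), convInl_mul_tmul _ _ u (ℛ k b)]
  simp only [map_sum, map_smul, WithConv.ofConv_sum, WithConv.ofConv_smul, LinearMap.sum_apply,
    LinearMap.smul_apply, (ℛ k c).convMul_apply, mul_convInl_tmul _ _ _ (ℛ k b),
    mul_convInr_tmul _ _ _ (ℛ k u), hmul, convScalar_apply, ← Algebra.smul_def,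
    pairLeft_apply, pairRight_apply, smul_eq_mul, Finset.mul_sum] at h ⊢
  refine Eq.trans ?_ (h.trans (Finset.sum_congr rfl fun i _ => Finset.sum_comm))
  rw [Finset.sum_comm]
  refine Finset.sum_congr rfl fun i _ => Finset.sum_comm.trans ?_
  exact Finset.sum_congr rfl fun j _ => Finset.sum_congr rfl fun l _ => by ring

lemma IsBraiding.thetaConv_doubleInner (hβ : IsBraiding β)
    (hinv₁ : conv β βi = Coalgebra.counit) (hinv₂ : conv βi β = Coalgebra.counit) (b u : A) :
    thetaConv β βi (doubleInner β βi (b ⊗ₜ u)) = pairRight βi u * pairLeft β b := by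
  have hS : (convInr (pairRight βi) : WithConv (A ⊗[k] A →ₗ[k] _)) * convInr (pairRight β) = 1 := by
    rw [← map_mul, pairRight_mul_pairRight _ _ hinv₂, map_one]
  have hT : (convInr (pairRight β) : WithConv (A ⊗[k] A →ₗ[k] _)) * convInr (pairRight βi) = 1 := by
    rw [← map_mul, pairRight_mul_pairRight _ _ hinv₁, map_one]
  have hb : convScalar (WithConv (A →ₗ[k] k)) (toConv β) * convScalar _ (toConv βi) = 1 := by
    rw [← map_mul, ← toConv_conv, hinv₁]
    exact map_one _
  have key : toConv (thetaConv β βi ∘ₗ doubleInner β βi) =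
      convInr (pairRight βi) * convInl (pairLeft β) := by
    rw [doubleInner, comp_conv_scalar_right, comp_conv_scalar_left, LinearMap.comp_id,
      toConv_thetaConv]
    calc _ = convInr (pairRight βi) * (convInr (pairRight β) *
          (convScalar _ (toConv β) * convInl (pairLeft β))) *
          convInr (pairRight βi) * convScalar _ (toConv βi) := by
          rw [← mul_assoc (convInr (pairRight βi)), hS, one_mul]; simp only [mul_assoc]
      _ = convInr (pairRight βi) * convInl (pairLeft β) * (convScalar _ (toConv β) *
          (convInr (pairRight β) * convInr (pairRight βi)) * convScalar _ (toConv βi)) := by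
          rw [hβ.yangBaxter]; simp only [mul_assoc]
      _ = _ := by rw [hT, mul_one, hb, mul_one]
  have h := congr($key (b ⊗ₜ u))
  rwa [convInr_mul_convInl_tmul] at h

lemma IsSkewPairing.thetaConv_mul (h : IsSkewPairing β)
    (hinv₁ : conv β βi = Coalgebra.counit) (hinv₂ : conv βi β = Coalgebra.counit)
    (a v : A) (t : A ⊗[k] A) :
    thetaConv β βi ((a ⊗ₜ 1) * t * (1 ⊗ₜ v)) =
      pairLeft β a * thetaConv β βi t * pairRight βi v := by
  induction t with
  | zero => simp
  | add s t hs ht => rw [mul_add, add_mul, map_add, hs, ht, map_add, mul_add, add_mul]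
  | tmul x y =>
    rw [Algebra.TensorProduct.tmul_mul_tmul, Algebra.TensorProduct.tmul_mul_tmul, one_mul, mul_one,
      thetaConv_tmul, thetaConv_tmul, h.pairLeft_mul, h.pairRight_inv_mul hinv₁ hinv₂]
    simp only [mul_assoc]

end Pairing

/-- θ is an algebra homomorphism from the double `A ⋈ A` to the convolution
algebra `A*`: it sends `1⊗1` to `ε` and products to convolution products. -/
theorem theta_algHom (β : A ⊗[k] A →ₗ[k] k) (hβ : IsBraiding β)
    (βi : A ⊗[k] A →ₗ[k] k)
    (hinv₁ : conv β βi = Coalgebra.counit) (hinv₂ : conv βi β = Coalgebra.counit)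
    -- the double multiplication (a⊗u)(b⊗v) = Σ β(b₁,u₁) ab₂ ⊗ u₂v β⁻¹(b₃,u₃)
    (mulD : (A ⊗[k] A) ⊗[k] (A ⊗[k] A) →ₗ[k] A ⊗[k] A)
    (hmulD : ∀ a u b v : A,
      mulD ((a ⊗ₜ u) ⊗ₜ (b ⊗ₜ v))
        = (a ⊗ₜ (1 : A)) * doubleInner β βi (b ⊗ₜ u) * ((1 : A) ⊗ₜ v)) :
    -- θ(1⊗1) = ε
    theta β βi (((1 : A) ⊗ₜ (1 : A)) : A ⊗[k] A) = Coalgebra.counit ∧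
    -- θ((a⊗b)(a'⊗b')) = θ(a⊗b) * θ(a'⊗b')
    (∀ a b a' b' : A,
      theta β βi (mulD ((a ⊗ₜ b) ⊗ₜ (a' ⊗ₜ b')))
        = conv (theta β βi (a ⊗ₜ b)) (theta β βi (a' ⊗ₜ b'))) := by
  refine ⟨WithConv.toConv_injective ?_, fun a b a' b' => toConv_injective ?_⟩
  · rw [theta_tmul, hβ.skew.pairLeft_one, hβ.skew.pairRight_inv_one hinv₁, one_mul]
    rfl
  · rw [toConv_conv, theta_tmul, theta_tmul, hmulD]
    refine (hβ.skew.thetaConv_mul hinv₁ hinv₂ a b' _).trans ?_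
    rw [hβ.thetaConv_doubleInner hinv₁ hinv₂]
    simp only [mul_assoc]

end
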